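/- Let p > 0, 0 < γ < 1 and let n ≥ 1 be an integer. Define F : (0,∞) → ℝ by F(q) = J_{n−2}(z₋(q)) · K_{n−2}(z₊(q)), where z_±(q) = √(2p)·(√(q²+γ²) ± q)^{1/2}. Then the p-extended Mathieu series satisfies S_{n−3/2, p}(γ) = (2(−1)^n √π / ((2γ)^{n−2} Γ(n − 1/2))) · ∑_{k≥1} F^{(n)}(k), where F^{(n)} denotes the n-th derivative of F. -/

import Mathlib

open Real MeasureTheory

/-- Bessel function of the first kind of integer order, via Bessel's integral. -/
noncomputable def besselJ (m : ℤ) (x : ℝ) : ℝ :=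
  (1 / Real.pi) * ∫ θ in (0:ℝ)..Real.pi, Real.cos ((m : ℝ) * θ - x * Real.sin θ)

/-- Modified Bessel function of the second kind (real argument). -/
noncomputable def besselK (ν x : ℝ) : ℝ :=
  ∫ t in Set.Ioi (0:ℝ), Real.exp (-x * Real.cosh t) * Real.cosh (ν * t)

/-- Modified Bessel function of the second kind (complex argument). -/
noncomputable def besselKC (ν : ℝ) (z : ℂ) : ℂ :=
  ∫ t in Set.Ioi (0:ℝ), Complex.exp (-z * (Real.cosh t : ℂ)) * (Real.cosh (ν * t) : ℂ)

/-- The p-extended Riemann zeta function. -/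
noncomputable def zetaP (p α : ℝ) : ℝ :=
  (1 / Real.Gamma α) *
    ∫ t in Set.Ioi (0:ℝ), t ^ (α - 1) * Real.exp (-p / t) / (Real.exp t - 1)

/-- The p-extended Mathieu series. -/
noncomputable def mathieuS (μ p r : ℝ) : ℝ :=
  2 * ∑' n : ℕ, (-1 : ℝ) ^ n *
      (Real.Gamma (μ + n + 1) / (n.factorial * Real.Gamma (μ + 1))) *
      zetaP p (2 * μ + 2 * n + 1) * r ^ (2 * n)

theorem besselJ_eq_unitCircle (m : ℤ) (x : ℝ) :
    (besselJ m x : ℂ) = (2 * π : ℂ)⁻¹ * ∫ θ in (0:ℝ)..2 * π,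
      (circleMap 0 1 θ) ^ (-m) *
        Complex.exp (x / 2 * (circleMap 0 1 θ - (circleMap 0 1 θ)⁻¹)) := by
  set c : ℝ → ℝ := fun θ => Real.cos ((m : ℝ) * θ - x * Real.sin θ) with hc
  set s : ℝ → ℝ := fun θ => Real.sin ((m : ℝ) * θ - x * Real.sin θ) with hs
  have hcc : Continuous c := by fun_prop
  have hsc : Continuous s := by fun_prop
  have hpt : ∀ θ : ℝ, (circleMap 0 1 θ) ^ (-m) *
        Complex.exp (x / 2 * (circleMap 0 1 θ - (circleMap 0 1 θ)⁻¹))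
        = (c θ : ℂ) - (s θ : ℂ) * Complex.I := by
    intro θ
    have h1 : circleMap 0 1 θ = Complex.exp (θ * Complex.I) := by simp [circleMap]
    rw [h1, ← Complex.exp_neg, ← Complex.exp_int_mul, ← Complex.exp_add]
    have h2 : Complex.exp (θ * Complex.I) - Complex.exp (-(θ * Complex.I))
        = 2 * Complex.I * Complex.sin θ := by
      rw [Complex.sin]; ring_nf; rw [Complex.I_sq]; ring
    rw [h2]
    have h3 : ((-m : ℤ) : ℂ) * (θ * Complex.I) + x / 2 * (2 * Complex.I * Complex.sin θ)
        = ((-((m : ℝ) * θ - x * Real.sin θ) : ℝ) : ℂ) * Complex.I := by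
      push_cast; ring
    rw [h3, Complex.exp_mul_I]
    simp only [hc, hs, ← Complex.ofReal_cos, ← Complex.ofReal_sin, Real.cos_neg, Real.sin_neg]
    push_cast; ring
  have hrefl : ∀ θ : ℝ, (m : ℝ) * (2 * π - θ) - x * Real.sin (2 * π - θ)
      = -((m : ℝ) * θ - x * Real.sin θ) + m * (2 * π) := by
    intro θ
    rw [Real.sin_two_pi_sub]; ring
  have hcr : ∀ θ, c (2 * π - θ) = c θ := by
    intro θ
    simp only [hc, hrefl, Real.cos_add_int_mul_two_pi, Real.cos_neg]
  have hsr : ∀ θ, s (2 * π - θ) = - s θ := by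
    intro θ
    simp only [hs, hrefl, Real.sin_add_int_mul_two_pi, Real.sin_neg]
  have hs0 : ∫ θ in (0:ℝ)..2 * π, s θ = 0 := by
    have := intervalIntegral.integral_comp_sub_left (a := 0) (b := 2 * π) s (2 * π)
    simp only [hsr, intervalIntegral.integral_neg, sub_self, sub_zero] at this
    linarith
  have hc0 : ∫ θ in (0:ℝ)..2 * π, c θ = 2 * ∫ θ in (0:ℝ)..π, c θ := by
    have h := intervalIntegral.integral_comp_sub_left (a := 0) (b := π) c (2 * π)
    simp only [hcr, sub_zero, show 2 * π - π = π by ring] at h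
    rw [← intervalIntegral.integral_add_adjacent_intervals (b := π)
      (hcc.intervalIntegrable _ _) (hcc.intervalIntegrable _ _), ← h]
    ring
  simp_rw [hpt]
  rw [intervalIntegral.integral_sub, intervalIntegral.integral_mul_const,
    intervalIntegral.integral_ofReal, intervalIntegral.integral_ofReal, hs0, hc0, besselJ]
  · push_cast
    have : (π : ℂ) ≠ 0 := by exact_mod_cast Real.pi_ne_zero
    field_simp
    simp only [hc]
    ring
  · exact (Complex.continuous_ofReal.comp hcc).intervalIntegrable _ _
  · exact ((Complex.continuous_ofReal.comp hsc).mul continuous_const).intervalIntegrable _ _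

theorem integral_circleMap_eq_circleIntegral (f : ℂ → ℂ) {ρ : ℝ} (hρ : 0 < ρ) :
    ∫ θ in (0:ℝ)..2 * π, f (circleMap 0 ρ θ)
      = Complex.I⁻¹ * ∮ w in C(0, ρ), w⁻¹ * f w := by
  rw [circleIntegral, ← intervalIntegral.integral_const_mul]
  refine intervalIntegral.integral_congr fun θ _ => ?_
  have : circleMap 0 ρ θ ≠ 0 := circleMap_ne_center hρ.ne'
  simp only [deriv_circleMap, smul_eq_mul]
  field_simp

theorem integral_circleMap_radius_indep {f : ℂ → ℂ}
    (hf : ∀ z ≠ 0, DifferentiableAt ℂ f z) {r R : ℝ} (hr : 0 < r) (hR : 0 < R) :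
    ∫ θ in (0:ℝ)..2 * π, f (circleMap 0 R θ) = ∫ θ in (0:ℝ)..2 * π, f (circleMap 0 r θ) := by
  wlog h : r ≤ R generalizing r R
  · exact (this hR hr (le_of_not_ge h)).symm
  rw [integral_circleMap_eq_circleIntegral f hr, integral_circleMap_eq_circleIntegral f hR]
  congr 1
  have := Complex.circleIntegral_sub_center_inv_smul_eq_of_differentiable_on_annulus_off_countable
    (c := 0) hr h (f := f) Set.countable_empty
    (fun z hz => (hf z (by
      rintro rfl; simp at hz; linarith)).continuousAt.continuousWithinAt)
    (fun z hz => hf z (by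
      rintro rfl; simp at hz; linarith))
  simpa using this

theorem besselJ_eq_circle (m : ℤ) (x : ℝ) {ρ : ℝ} (hρ : 0 < ρ) :
    (besselJ m x : ℂ) = (2 * π : ℂ)⁻¹ * ∫ θ in (0:ℝ)..2 * π,
      (circleMap 0 ρ θ) ^ (-m) *
        Complex.exp (x / 2 * (circleMap 0 ρ θ - (circleMap 0 ρ θ)⁻¹)) := by
  rw [besselJ_eq_unitCircle]
  congr 1
  refine integral_circleMap_radius_indep
    (f := fun w => w ^ (-m) * Complex.exp (x / 2 * (w - w⁻¹))) (fun z hz => ?_) hρ one_pos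
  have h1 : DifferentiableAt ℂ (fun w : ℂ => w ^ (-m)) z :=
    differentiableAt_zpow.2 (Or.inl hz)
  have h2 : DifferentiableAt ℂ (fun w : ℂ => w⁻¹) z := differentiableAt_inv hz
  fun_prop

theorem integral_circleMap_zpow_mul_exp (j : ℤ) (a : ℂ) :
    ∫ θ in (0:ℝ)..2 * π, (circleMap 0 1 θ) ^ (-j) * Complex.exp (a * circleMap 0 1 θ)
      = 2 * π * (a ^ j * ((Real.Gamma (j + 1))⁻¹ : ℝ)) := by
  rw [integral_circleMap_eq_circleIntegral (fun w => w ^ (-j) * Complex.exp (a * w)) one_pos]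
  have hd : Differentiable ℂ fun w : ℂ => Complex.exp (a * w) := by fun_prop
  rcases le_or_gt 0 j with hj | hj
  · lift j to ℕ using hj
    have := (hd.differentiableOn (s := Metric.closedBall 0 1)
      ).circleIntegral_one_div_sub_center_pow_smul one_pos j
    rw [iteratedDeriv_cexp_const_mul] at this
    simp only [sub_zero, mul_zero, Complex.exp_zero, smul_eq_mul, mul_one] at this
    have h2 : ∮ w in C(0, 1), w⁻¹ * (w ^ (-(j : ℤ)) * Complex.exp (a * w))
       = ∮ w in C(0, 1), 1 / w ^ (j + 1) * Complex.exp (a * w) := by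
      refine circleIntegral.integral_congr zero_le_one fun w hw => ?_
      simp only [zpow_neg, zpow_natCast, pow_succ]
      field_simp
    rw [h2, this]
    simp only [Int.cast_natCast, Real.Gamma_nat_eq_factorial, zpow_natCast]
    push_cast
    field_simp
  · have h2 : ∮ w in C(0, 1), w⁻¹ * (w ^ (-j) * Complex.exp (a * w))
       = ∮ w in C(0, 1), w ^ (-j - 1).toNat * Complex.exp (a * w) := by
      refine circleIntegral.integral_congr zero_le_one fun w hw => ?_
      have hw0 : w ≠ 0 := by rintro rfl; simp at hw
      have : ((-j - 1).toNat : ℤ) = -j - 1 := Int.toNat_of_nonneg (by lia)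
      rw [← zpow_natCast w, this, zpow_sub_one₀ hw0]; ring
    rw [h2, DiffContOnCl.circleIntegral_eq_zero zero_le_one]
    · have : Real.Gamma (j + 1) = 0 := by
        have := Real.Gamma_neg_nat_eq_zero (-j - 1).toNat
        rw [← this]; congr 1
        have : ((-j - 1).toNat : ℤ) = -j - 1 := Int.toNat_of_nonneg (by lia)
        have : (((-j - 1).toNat : ℤ) : ℝ) = ((-j - 1 : ℤ) : ℝ) := by rw [this]
        push_cast at this
        rw [this]; ring
      simp [this]
    · exact Differentiable.diffContOnCl (by fun_prop)

theorem norm_circleMap_one (θ : ℝ) : ‖circleMap 0 1 θ‖ = 1 := by simp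

theorem hasSum_integral_circleMap (m : ℤ) {x : ℝ} (hx : x ≠ 0) (ε : ℝ) :
    HasSum (fun k : ℕ => ((ε ^ k *
        ((x / 2) ^ (2 * k + m) / (k.factorial * Real.Gamma (k + m + 1))) : ℝ) : ℂ))
      ((2 * π : ℂ)⁻¹ * ∫ θ in (0:ℝ)..2 * π, (circleMap 0 1 θ) ^ (-m) *
        Complex.exp (x / 2 * (circleMap 0 1 θ + ε * (circleMap 0 1 θ)⁻¹))) := by
  have hne : ∀ θ, circleMap 0 1 θ ≠ 0 := fun θ => circleMap_ne_center one_ne_zero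
  have hcont : ∀ j : ℤ, Continuous fun θ => (circleMap 0 1 θ) ^ j := fun j =>
    (continuous_circleMap 0 1).zpow₀ j fun θ => Or.inl (hne θ)
  have hexp : Continuous fun θ => Complex.exp (x / 2 * circleMap 0 1 θ) := by fun_prop
  have key := intervalIntegral.hasSum_integral_of_dominated_convergence
    (μ := volume) (a := 0) (b := 2 * π)
    (F := fun (k : ℕ) θ => (circleMap 0 1 θ) ^ (-m) * Complex.exp (x / 2 * circleMap 0 1 θ) *
      ((x / 2 * ε * (circleMap 0 1 θ)⁻¹) ^ k / k.factorial))
    (f := fun θ => (circleMap 0 1 θ) ^ (-m) *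
        Complex.exp (x / 2 * (circleMap 0 1 θ + ε * (circleMap 0 1 θ)⁻¹)))
    (bound := fun k _ => Real.exp (|x| / 2) * ((|x| / 2 * |ε|) ^ k / k.factorial))
    (fun k => ?_) (fun k => ?_) ?_ ?_ ?_
  · have hterm : ∀ k : ℕ, (∫ θ in (0:ℝ)..2 * π,
        (circleMap 0 1 θ) ^ (-m) * Complex.exp (x / 2 * circleMap 0 1 θ) *
          ((x / 2 * ε * (circleMap 0 1 θ)⁻¹) ^ k / k.factorial))
        = 2 * π * ((ε ^ k *
          ((x / 2) ^ (2 * k + m) / (k.factorial * Real.Gamma (k + m + 1))) : ℝ) : ℂ) := by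
      intro k
      have h1 : ∀ θ, (circleMap 0 1 θ) ^ (-m) * Complex.exp (x / 2 * circleMap 0 1 θ) *
          ((x / 2 * ε * (circleMap 0 1 θ)⁻¹) ^ k / k.factorial)
          = (x / 2 * ε) ^ k / k.factorial *
            ((circleMap 0 1 θ) ^ (-(k + m)) * Complex.exp (x / 2 * circleMap 0 1 θ)) := by
        intro θ
        rw [neg_add, zpow_add₀ (hne θ), zpow_neg _ (k : ℤ), zpow_natCast, mul_pow _ (_⁻¹), inv_pow]
        ring
      simp_rw [h1]
      rw [intervalIntegral.integral_const_mul, integral_circleMap_zpow_mul_exp]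
      have hx2 : (x / 2 : ℂ) ≠ 0 := by
        simpa using hx
      have h2 : (x / 2 : ℂ) ^ (2 * k + m) = (x / 2) ^ k * (x / 2) ^ ((k : ℤ) + m) := by
        rw [← zpow_natCast, ← zpow_add₀ hx2]; congr 1; ring
      push_cast
      rw [h2, mul_pow]
      field_simp
    have := key.mul_left ((2 * π : ℂ)⁻¹)
    refine this.congr_fun ?_
    intro k
    rw [hterm]
    have : (π : ℂ) ≠ 0 := by exact_mod_cast Real.pi_ne_zero
    field_simp
  · refine Continuous.aestronglyMeasurable ?_
    have h1 := hcont (-m)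
    have h2 : Continuous fun θ => (circleMap 0 1 θ)⁻¹ :=
      (continuous_circleMap 0 1).inv₀ hne
    fun_prop
  · refine Filter.Eventually.of_forall fun θ _ => ?_
    rw [norm_mul, norm_mul, norm_zpow, norm_div, norm_pow, norm_mul, norm_mul, norm_inv,
      norm_circleMap_one, Complex.norm_exp]
    simp only [one_zpow, one_mul, inv_one, mul_one, Complex.norm_natCast, norm_div,
      Complex.norm_real, Complex.norm_ofNat, Real.norm_eq_abs]
    gcongr
    refine (Complex.re_le_norm _).trans ?_
    simp
  · exact Filter.Eventually.of_forall fun θ _ =>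
      (Real.summable_pow_div_factorial _).mul_left _
  · exact intervalIntegrable_const
  · refine Filter.Eventually.of_forall fun θ _ => ?_
    rw [mul_add, Complex.exp_add, ← mul_assoc, ← mul_assoc]
    refine HasSum.mul_left _ ?_
    rw [Complex.exp_eq_exp_ℂ]
    exact NormedSpace.expSeries_div_hasSum_exp _

theorem besselJ_hasSum (m : ℤ) {x : ℝ} (hx : x ≠ 0) :
    HasSum (fun k : ℕ => (-1) ^ k *
      ((x / 2) ^ (2 * k + m) / (k.factorial * Real.Gamma (k + m + 1)))) (besselJ m x) := by
  have := hasSum_integral_circleMap m hx (-1)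
  simp only [Complex.ofReal_neg, Complex.ofReal_one, neg_mul, one_mul, ← sub_eq_add_neg] at this
  rw [← besselJ_eq_unitCircle] at this
  exact Complex.hasSum_ofReal.1 this

theorem sum_besselI_terms_le (m : ℤ) (hm : -1 ≤ m) {x : ℝ} (hx : 0 < x) (N : ℕ) :
    ∑ k ∈ Finset.range N, (x / 2) ^ (2 * k + m) / (k.factorial * Real.Gamma (k + m + 1))
      ≤ Real.exp x := by
  have h := hasSum_integral_circleMap m hx.ne' 1
  simp only [Complex.ofReal_one, one_pow, one_mul] at h
  set T := ((2 * π : ℂ)⁻¹ * ∫ θ in (0:ℝ)..2 * π, (circleMap 0 1 θ) ^ (-m) *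
        Complex.exp (x / 2 * (circleMap 0 1 θ + (circleMap 0 1 θ)⁻¹)))
  have hT : ‖T‖ ≤ Real.exp x := by
    have h1 : ‖∫ θ in (0:ℝ)..2 * π, (circleMap 0 1 θ) ^ (-m) *
        Complex.exp (x / 2 * (circleMap 0 1 θ + (circleMap 0 1 θ)⁻¹))‖
        ≤ Real.exp x * |2 * π - 0| := by
      refine intervalIntegral.norm_integral_le_of_norm_le_const fun θ _ => ?_
      rw [norm_mul, norm_zpow, norm_circleMap_one, one_zpow, one_mul, Complex.norm_exp]
      gcongr
      refine (Complex.re_le_norm _).trans ?_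
      rw [norm_mul]
      have : ‖circleMap 0 1 θ + (circleMap 0 1 θ)⁻¹‖ ≤ 2 := by
        refine (norm_add_le _ _).trans ?_
        rw [norm_inv, norm_circleMap_one]; norm_num
      have h3 : ‖(x / 2 : ℂ)‖ = x / 2 := by simp [abs_of_pos hx]
      rw [h3]
      nlinarith
    have hpi := Real.pi_pos
    rw [sub_zero, abs_of_pos (by positivity)] at h1
    rw [norm_mul, norm_inv]
    have : ‖(2 * π : ℂ)‖ = 2 * π := by simp [abs_of_pos hpi]
    rw [this, inv_mul_le_iff₀ (by positivity)]
    linarith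
  have hre := Complex.hasSum_re h
  simp only [Complex.ofReal_re] at hre
  refine (sum_le_hasSum _ (fun k _ => ?_) hre).trans ((Complex.re_le_norm _).trans hT)
  have : 0 ≤ Real.Gamma (k + m + 1) := by
    refine Real.Gamma_nonneg_of_nonneg ?_
    have : (-1 : ℝ) ≤ m := by exact_mod_cast hm
    have : (0 : ℝ) ≤ k := by positivity
    linarith
  positivity

theorem integrableOn_rpow_mul_exp_neg_sub_div (k : ℝ) {A B : ℝ} (hA : 0 < A) (hB : 0 < B) :
    IntegrableOn (fun t : ℝ => t ^ k * Real.exp (-(A * t) - B / t)) (Set.Ioi 0) := by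
  obtain ⟨N, hN⟩ := exists_nat_gt (-1 - k)
  have h := (integrableOn_rpow_mul_exp_neg_mul_rpow (s := k + N) (p := 1) (b := A)
    (by linarith) one_pos hA).const_mul (N.factorial / B ^ N)
  refine Integrable.mono' h ?_ ?_
  · refine ContinuousOn.aestronglyMeasurable ?_ measurableSet_Ioi
    intro t ht
    have ht' : t ≠ 0 := (Set.mem_Ioi.1 ht).ne'
    refine ContinuousAt.continuousWithinAt ?_
    have h1 : ContinuousAt (fun t : ℝ => t ^ k) t :=
      Real.continuousAt_rpow_const _ _ (Or.inl ht')
    have h2 : ContinuousAt (fun t : ℝ => B / t) t := continuousAt_const.div continuousAt_id ht'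
    fun_prop
  · refine (ae_restrict_iff' measurableSet_Ioi).2 (Filter.Eventually.of_forall fun t ht => ?_)
    have ht : 0 < t := ht
    have h1 := Real.pow_div_factorial_le_exp (B / t) (by positivity) N
    rw [Real.norm_of_nonneg (by positivity), Real.rpow_one, Real.rpow_add ht, Real.rpow_natCast,
      sub_eq_add_neg, Real.exp_add, Real.exp_neg (B / t), neg_mul]
    have h2 : (Real.exp (B / t))⁻¹ ≤ N.factorial / B ^ N * t ^ N := by
      rw [inv_le_iff_one_le_mul₀ (Real.exp_pos _)]
      calc (1 : ℝ) = N.factorial / B ^ N * t ^ N * ((B / t) ^ N / N.factorial) := by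
            rw [div_pow]; field_simp
        _ ≤ _ := by gcongr
    calc t ^ k * (Real.exp (-(A * t)) * (Real.exp (B / t))⁻¹)
        ≤ t ^ k * (Real.exp (-(A * t)) * (N.factorial / B ^ N * t ^ N)) := by gcongr
      _ = _ := by ring

theorem integral_Ioi_eq_integral_exp {E : Type*} [NormedAddCommGroup E] [NormedSpace ℝ E]
    (g : ℝ → E) : ∫ t in Set.Ioi (0:ℝ), g t = ∫ x : ℝ, Real.exp x • g (Real.exp x) := by
  have := integral_image_eq_integral_abs_deriv_smul (s := Set.univ) (f := Real.exp)
    (f' := Real.exp) MeasurableSet.univ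
    (fun x _ => (Real.hasDerivAt_exp x).hasDerivWithinAt) Real.exp_injective.injOn g
  simpa [Set.image_univ, Real.range_exp, abs_of_pos (Real.exp_pos _)] using this

theorem integrableOn_Ioi_iff_integrable_exp {E : Type*} [NormedAddCommGroup E] [NormedSpace ℝ E]
    (g : ℝ → E) : IntegrableOn g (Set.Ioi (0:ℝ)) ↔
      Integrable fun x : ℝ => Real.exp x • g (Real.exp x) := by
  have := integrableOn_image_iff_integrableOn_abs_deriv_smul (s := Set.univ) (f := Real.exp)
    (f' := Real.exp) MeasurableSet.univ
    (fun x _ => (Real.hasDerivAt_exp x).hasDerivWithinAt) Real.exp_injective.injOn g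
  simpa [Set.image_univ, Real.range_exp, abs_of_pos (Real.exp_pos _)] using this

theorem integrable_exp_mul_exp_neg (k : ℝ) {A B : ℝ} (hA : 0 < A) (hB : 0 < B) :
    Integrable fun x : ℝ =>
      Real.exp (k * x) * Real.exp (-(A * Real.exp x) - B * Real.exp (-x)) := by
  have := (integrableOn_Ioi_iff_integrable_exp _).1
    (integrableOn_rpow_mul_exp_neg_sub_div (k - 1) hA hB)
  refine this.congr (Filter.Eventually.of_forall fun x => ?_)
  simp only [smul_eq_mul]
  rw [← mul_assoc, ← Real.exp_mul, ← Real.exp_add, div_eq_mul_inv, ← Real.exp_neg]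
  ring_nf

theorem norm_cexp_neg_sub (a b : ℂ) (x : ℝ) :
    ‖Complex.exp (-(a * Real.exp x) - b * Real.exp (-x))‖
      = Real.exp (-(a.re * Real.exp x) - b.re * Real.exp (-x)) := by
  rw [Complex.norm_exp, Complex.sub_re, Complex.neg_re, Complex.re_mul_ofReal,
    Complex.re_mul_ofReal]

theorem integrable_cexp_neg_sub {a b : ℂ} (ha : 0 < a.re) (hb : 0 < b.re) :
    Integrable fun x : ℝ => Complex.exp (-(a * Real.exp x) - b * Real.exp (-x)) := by
  have := integrable_exp_mul_exp_neg 0 ha hb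
  refine this.mono' (Continuous.aestronglyMeasurable (by fun_prop))
    (Filter.Eventually.of_forall fun x => ?_)
  rw [norm_cexp_neg_sub]; simp

theorem integral_deriv_cexp_neg_sub {a b : ℂ} (ha : 0 < a.re) (hb : 0 < b.re) :
    ∫ x : ℝ, (-(a * Real.exp x) + b * Real.exp (-x)) *
      Complex.exp (-(a * Real.exp x) - b * Real.exp (-x)) = 0 := by
  refine integral_eq_zero_of_hasDerivAt_of_integrable
    (f := fun x : ℝ => Complex.exp (-(a * Real.exp x) - b * Real.exp (-x)))
    (fun x => ?_) ?_ (integrable_cexp_neg_sub ha hb)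
  · have h1 : HasDerivAt (fun x : ℝ => (Real.exp x : ℂ)) (Real.exp x : ℂ) x :=
      (Real.hasDerivAt_exp x).ofReal_comp
    have h2 : HasDerivAt (fun x : ℝ => (Real.exp (-x) : ℂ)) ((-Real.exp (-x) : ℝ) : ℂ) x := by
      have := ((Real.hasDerivAt_exp (-x)).comp x (hasDerivAt_neg x)).ofReal_comp
      simpa using this
    have h3 : HasDerivAt (fun x : ℝ => -(a * Real.exp x) - b * Real.exp (-x))
        (-(a * Real.exp x) - b * ((-Real.exp (-x) : ℝ) : ℂ)) x :=
      (h1.const_mul a).neg.sub (h2.const_mul b)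
    refine h3.cexp.congr_deriv ?_
    push_cast; ring
  · have h1 := (integrable_exp_mul_exp_neg 1 ha hb).const_mul ‖a‖
    have h2 := (integrable_exp_mul_exp_neg (-1) ha hb).const_mul ‖b‖
    refine (h1.add h2).mono' (Continuous.aestronglyMeasurable (by fun_prop))
      (Filter.Eventually.of_forall fun x => ?_)
    rw [norm_mul, norm_cexp_neg_sub]
    have : ‖-(a * Real.exp x) + b * Real.exp (-x)‖
        ≤ ‖a‖ * Real.exp x + ‖b‖ * Real.exp (-x) := by
      refine (norm_add_le _ _).trans_eq ?_
      rw [norm_neg, norm_mul, norm_mul]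
      simp only [Complex.norm_real, Real.norm_eq_abs, Real.abs_exp]
    simp only [Pi.add_apply, one_mul, neg_one_mul]
    calc _ ≤ (‖a‖ * Real.exp x + ‖b‖ * Real.exp (-x)) * _ := by gcongr
      _ = _ := by ring

theorem hasDerivAt_integral_cexp_neg_sub {P a₀ : ℂ} (ha : 0 < a₀.re) (hb : 0 < (P / a₀).re) :
    HasDerivAt (fun a : ℂ => ∫ x : ℝ, Complex.exp (-(a * Real.exp x) - P / a * Real.exp (-x)))
      0 a₀ := by
  have ha0 : a₀ ≠ 0 := by rintro rfl; simp at ha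
  obtain ⟨δ, hδ, hδ1, hδ2⟩ : ∃ δ > 0, δ < a₀.re ∧ δ < (P / a₀).re := by
    refine ⟨min a₀.re (P / a₀).re / 2, by positivity, ?_, ?_⟩
    · have := min_le_left a₀.re (P / a₀).re; linarith
    · have := min_le_right a₀.re (P / a₀).re; linarith
  have hcdiv : ContinuousAt (fun a : ℂ => P / a) a₀ := continuousAt_const.div continuousAt_id ha0
  have hcdiv2 : ContinuousAt (fun a : ℂ => ‖P / a ^ 2‖) a₀ :=
    (continuousAt_const.div (continuousAt_id.pow 2) (pow_ne_zero 2 ha0)).norm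
  set M := ‖P / a₀ ^ 2‖ + 1 with hM
  have hev : ∀ᶠ a in nhds a₀, δ < a.re ∧ δ < (P / a).re ∧ ‖P / a ^ 2‖ < M :=
    (Complex.continuous_re.continuousAt.eventually_const_lt hδ1).and
      (((Complex.continuous_re.continuousAt.comp hcdiv).eventually_const_lt hδ2).and
        (hcdiv2.eventually_lt_const (by rw [hM]; linarith)))
  have key := (hasDerivAt_integral_of_dominated_loc_of_deriv_le (μ := volume)
    (F := fun (a : ℂ) (x : ℝ) => Complex.exp (-(a * Real.exp x) - P / a * Real.exp (-x)))
    (F' := fun (a : ℂ) (x : ℝ) => (-(Real.exp x : ℂ) + P / a ^ 2 * Real.exp (-x)) *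
      Complex.exp (-(a * Real.exp x) - P / a * Real.exp (-x)))
    (bound := fun x => Real.exp (1 * x) * Real.exp (-(δ * Real.exp x) - δ * Real.exp (-x)) +
      M * (Real.exp (-1 * x) * Real.exp (-(δ * Real.exp x) - δ * Real.exp (-x))))
    (x₀ := a₀) hev ?_ (integrable_cexp_neg_sub ha hb) ?_ ?_ ?_ ?_).2
  · refine key.congr_deriv (Eq.symm ?_)
    rw [show (0 : ℂ) = a₀⁻¹ * 0 by simp, ← integral_deriv_cexp_neg_sub ha hb,
      ← integral_const_mul]
    refine integral_congr_ae (Filter.Eventually.of_forall fun x => ?_)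
    simp only
    field_simp
  · exact Filter.Eventually.of_forall fun a => Continuous.aestronglyMeasurable (by fun_prop)
  · exact Continuous.aestronglyMeasurable (by fun_prop)
  · refine Filter.Eventually.of_forall fun x a ⟨h1, h2, h3⟩ => ?_
    rw [norm_mul, norm_cexp_neg_sub]
    have : ‖-(Real.exp x : ℂ) + P / a ^ 2 * Real.exp (-x)‖
        ≤ Real.exp x + M * Real.exp (-x) := by
      refine (norm_add_le _ _).trans ?_
      rw [norm_neg, norm_mul]
      simp only [Complex.norm_real, Real.norm_eq_abs, Real.abs_exp]
      gcongr
    have hle : Real.exp (-(a.re * Real.exp x) - (P / a).re * Real.exp (-x))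
        ≤ Real.exp (-(δ * Real.exp x) - δ * Real.exp (-x)) := by
      gcongr
    calc _ ≤ (Real.exp x + M * Real.exp (-x)) * Real.exp (-(δ * Real.exp x) - δ * Real.exp (-x)) := by
          have : 0 ≤ M := by positivity
          gcongr
      _ = _ := by simp only [one_mul, neg_one_mul]; ring
  · exact (integrable_exp_mul_exp_neg 1 hδ hδ).add
      ((integrable_exp_mul_exp_neg (-1) hδ hδ).const_mul M)
  · refine Filter.Eventually.of_forall fun x a ⟨h1, h2, h3⟩ => ?_
    have ha : a ≠ 0 := by rintro rfl; simp at h1; linarith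
    have hd : HasDerivAt (fun a : ℂ => -(a * Real.exp x) - P / a * Real.exp (-x))
        (-(Real.exp x : ℂ) + P / a ^ 2 * Real.exp (-x)) a := by
      have e1 := ((hasDerivAt_id a).mul_const (Real.exp x : ℂ)).neg
      have e2 := (((hasDerivAt_inv ha).const_mul P)).mul_const (Real.exp (-x) : ℂ)
      refine (e1.sub e2).congr_deriv ?_
      field_simp
      ring
    exact hd.cexp.congr_deriv (mul_comm _ _)

theorem integral_cexp_neg_sub_eq_of_mul_eq {a b a' b' : ℂ} (ha : 0 < a.re) (hb : 0 < b.re)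
    (ha' : 0 < a'.re) (hb' : 0 < b'.re) (h : a * b = a' * b') :
    ∫ x : ℝ, Complex.exp (-(a * Real.exp x) - b * Real.exp (-x))
      = ∫ x : ℝ, Complex.exp (-(a' * Real.exp x) - b' * Real.exp (-x)) := by
  set P := a * b with hP
  set U : Set ℂ := {z | 0 < z.re} ∩ {z | 0 < (P * (starRingEnd ℂ) z).re} with hU
  have hne : ∀ z : ℂ, 0 < z.re → z ≠ 0 := by rintro _ hz rfl; simp at hz
  have hdiv : ∀ z : ℂ, z ≠ 0 → (0 < (P / z).re ↔ 0 < (P * (starRingEnd ℂ) z).re) := by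
    intro z hz
    have : P / z = ((Complex.normSq z)⁻¹ : ℝ) * (P * (starRingEnd ℂ) z) := by
      rw [div_eq_mul_inv, Complex.inv_def]; ring
    rw [this, Complex.re_ofReal_mul]
    have : 0 < Complex.normSq z := Complex.normSq_pos.2 hz
    constructor
    · intro h; exact pos_of_mul_pos_right h (by positivity)
    · intro h; positivity
  have hopen : IsOpen U :=
    (isOpen_lt continuous_const Complex.continuous_re).inter
      (isOpen_lt continuous_const (by fun_prop))
  have hconv : Convex ℝ U := by
    intro z hz w hw s t hs ht hst
    simp only [hU, Set.mem_inter_iff, Set.mem_ofPred_eq] at hz hw ⊢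
    have e : (s • z + t • w).re = s * z.re + t * w.re := by simp
    have e2 : (P * (starRingEnd ℂ) (s • z + t • w)).re
        = s * (P * (starRingEnd ℂ) z).re + t * (P * (starRingEnd ℂ) w).re := by
      simp; ring
    rw [e, e2]
    rcases hs.eq_or_lt with rfl | hs'
    · have : t = 1 := by linarith
      subst this; simpa using hw
    · exact ⟨by nlinarith [mul_pos hs' hz.1, mul_nonneg ht hw.1.le],
        by nlinarith [mul_pos hs' hz.2, mul_nonneg ht hw.2.le]⟩
  have hder : ∀ z ∈ U, HasDerivAt (fun a : ℂ => ∫ x : ℝ,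
      Complex.exp (-(a * Real.exp x) - P / a * Real.exp (-x))) 0 z := fun z hz =>
    hasDerivAt_integral_cexp_neg_sub hz.1 ((hdiv z (hne z hz.1)).2 hz.2)
  have eb : P / a = b := by rw [hP]; field_simp [hne a ha]
  have eb' : P / a' = b' := by rw [h]; field_simp [hne a' ha']
  have := hopen.is_const_of_deriv_eq_zero hconv.isPreconnected
    (fun z hz => (hder z hz).differentiableAt.differentiableWithinAt)
    (fun z hz => (hder z hz).deriv)
    (x := a) (y := a')
    ⟨ha, (hdiv a (hne a ha)).1 (by rwa [eb])⟩ ⟨ha', (hdiv a' (hne a' ha')).1 (by rwa [eb'])⟩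
  simpa only [eb, eb'] using this

theorem two_mul_besselK (ν : ℝ) {z : ℝ} (hz : 0 < z) :
    2 * besselK ν z = ∫ x : ℝ, Real.exp (-ν * x) * Real.exp (-z * Real.cosh x) := by
  have hcosh : ∀ x : ℝ, -z * Real.cosh x = -(z / 2 * Real.exp x) - z / 2 * Real.exp (-x) := by
    intro x; rw [Real.cosh_eq]; ring
  have hint : ∀ k : ℝ, Integrable fun x : ℝ => Real.exp (k * x) * Real.exp (-z * Real.cosh x) := by
    intro k
    simp_rw [hcosh]
    exact integrable_exp_mul_exp_neg k (half_pos hz) (half_pos hz)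
  have hrefl : ∫ x : ℝ, Real.exp (ν * x) * Real.exp (-z * Real.cosh x)
      = ∫ x : ℝ, Real.exp (-ν * x) * Real.exp (-z * Real.cosh x) := by
    rw [← integral_neg_eq_self]
    simp [Real.cosh_neg]
  have habs := integral_comp_abs (f := fun t => Real.exp (-z * Real.cosh t) * Real.cosh (ν * t))
  rw [besselK, ← habs]
  have hpt : ∀ x : ℝ, Real.exp (-z * Real.cosh |x|) * Real.cosh (ν * |x|)
      = (1 / 2) * (Real.exp (ν * x) * Real.exp (-z * Real.cosh x)
        + Real.exp (-ν * x) * Real.exp (-z * Real.cosh x)) := by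
    intro x
    have : Real.cosh (ν * |x|) = Real.cosh (ν * x) := by
      rw [← Real.cosh_abs, abs_mul, abs_abs, ← abs_mul, Real.cosh_abs]
    rw [Real.cosh_abs, this, Real.cosh_eq (ν * x)]
    ring_nf
  simp_rw [hpt]
  rw [integral_const_mul, integral_add (hint ν) (hint (-ν)), hrefl]
  ring

theorem integrable_circleMap_mul_cexp (m : ℤ) {a b : ℝ → ℂ} (ha : Continuous a)
    (hb : Continuous b) {A B : ℝ} (hA : 0 < A) (hB : 0 < B) (haA : ∀ θ, A ≤ (a θ).re)
    (hbB : ∀ θ, B ≤ (b θ).re) :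
    Integrable (Function.uncurry fun (θ x : ℝ) => (circleMap 0 1 θ) ^ (-m) *
      Complex.exp (-(a θ * Real.exp x) - b θ * Real.exp (-x)))
      ((volume.restrict (Set.uIoc 0 (2 * π))).prod volume) := by
  have : IsFiniteMeasure (volume.restrict (Set.uIoc 0 (2 * π))) := by
    rw [Set.uIoc]; infer_instance
  have h1 := (integrable_exp_mul_exp_neg 0 hA hB).comp_snd
    (volume.restrict (Set.uIoc 0 (2 * π)))
  have h2 : Continuous fun θ => (circleMap 0 1 θ) ^ (-m) :=
    (continuous_circleMap 0 1).zpow₀ _ fun θ => Or.inl (circleMap_ne_center one_ne_zero)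
  refine h1.mono' (Continuous.aestronglyMeasurable ?_) (Filter.Eventually.of_forall ?_)
  · have h3 : Continuous fun z : ℝ × ℝ => (circleMap 0 1 z.1) ^ (-m) := h2.comp continuous_fst
    simp only [Function.uncurry_def]
    fun_prop
  · rintro ⟨θ, x⟩
    simp only [Function.uncurry_apply_pair]
    rw [norm_mul, norm_zpow, norm_circleMap_one, one_zpow, norm_cexp_neg_sub]
    have := haA θ
    have := hbB θ
    simp only [zero_mul, Real.exp_zero, one_mul]
    gcongr

theorem integral_integral_circleMap_eq (m : ℤ) {a b a' b' : ℝ → ℂ} (ha : Continuous a)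
    (hb : Continuous b) (ha' : Continuous a') (hb' : Continuous b') {A B A' B' : ℝ} (hA : 0 < A)
    (hB : 0 < B) (hA' : 0 < A') (hB' : 0 < B') (haA : ∀ θ, A ≤ (a θ).re) (hbB : ∀ θ, B ≤ (b θ).re)
    (haA' : ∀ θ, A' ≤ (a' θ).re) (hbB' : ∀ θ, B' ≤ (b' θ).re)
    (h : ∀ θ, a θ * b θ = a' θ * b' θ) :
    ∫ x : ℝ, ∫ θ in (0:ℝ)..2 * π, (circleMap 0 1 θ) ^ (-m) *
        Complex.exp (-(a θ * Real.exp x) - b θ * Real.exp (-x))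
      = ∫ x : ℝ, ∫ θ in (0:ℝ)..2 * π, (circleMap 0 1 θ) ^ (-m) *
        Complex.exp (-(a' θ * Real.exp x) - b' θ * Real.exp (-x)) := by
  rw [← intervalIntegral_integral_swap (integrable_circleMap_mul_cexp m ha hb hA hB haA hbB),
    ← intervalIntegral_integral_swap (integrable_circleMap_mul_cexp m ha' hb' hA' hB' haA' hbB')]
  refine intervalIntegral.integral_congr fun θ _ => ?_
  rw [integral_const_mul, integral_const_mul,
    integral_cexp_neg_sub_eq_of_mul_eq (hA.trans_le (haA θ)) (hB.trans_le (hbB θ))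
      (hA'.trans_le (haA' θ)) (hB'.trans_le (hbB' θ)) (h θ)]

theorem integral_exp_mul_besselJ (m : ℤ) {p q γ y z : ℝ} (hp : 0 < p) (hq : 0 < q)
    (hyz : |y| < z) (hsq : z ^ 2 - y ^ 2 = 4 * p * q) (hmul : y * z = 2 * p * γ) :
    ∫ x : ℝ, Real.exp (-(q * Real.exp x) - p * Real.exp (-x)) * besselJ m (γ * Real.exp x)
      = 2 * (besselJ m y * besselK m z) := by
  have hz : 0 < z := (abs_nonneg y).trans_lt hyz
  have hne : ∀ θ, circleMap 0 1 θ ≠ 0 := fun θ => circleMap_ne_center one_ne_zero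
  have hinv : Continuous fun θ => (circleMap 0 1 θ)⁻¹ := (continuous_circleMap 0 1).inv₀ hne
  have hinv_eq : ∀ θ, (circleMap 0 1 θ)⁻¹ = (starRingEnd ℂ) (circleMap 0 1 θ) := fun θ => by
    rw [Complex.inv_def, Complex.normSq_eq_norm_sq, norm_circleMap_one]; simp
  have hre : ∀ θ, |(circleMap 0 1 θ).re| ≤ 1 := fun θ =>
    (Complex.abs_re_le_norm _).trans_eq (norm_circleMap_one θ)
  have hyre : ∀ θ, |y * (circleMap 0 1 θ).re| ≤ |y| := fun θ => by
    rw [abs_mul]; exact mul_le_of_le_one_right (abs_nonneg y) (hre θ)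
  have hswap := integral_integral_circleMap_eq m
    (a := fun θ => (z + y * (circleMap 0 1 θ)⁻¹) / 2)
    (b := fun θ => (z - y * circleMap 0 1 θ) / 2)
    (a' := fun θ => q - γ / 2 * (circleMap 0 1 θ - (circleMap 0 1 θ)⁻¹))
    (b' := fun _ => (p : ℂ)) (A := (z - |y|) / 2) (B := (z - |y|) / 2) (A' := q) (B' := p)
    (by fun_prop) (by fun_prop) (by fun_prop) (by fun_prop)
    (by linarith) (by linarith) hq hp
    (fun θ => ?_) (fun θ => ?_) (fun θ => ?_) (fun θ => by simp) (fun θ => ?_)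
  · have hpi : (2 * π : ℂ) ≠ 0 := by exact_mod_cast Real.two_pi_pos.ne'
    have hcancel : ∀ c d : ℂ, (2 * π : ℂ) * (c * ((2 * π : ℂ)⁻¹ * d)) = c * d := by
      intro c d
      rw [mul_left_comm, mul_inv_cancel_left₀ hpi]
    have hL : ∀ x : ℝ, (∫ θ in (0:ℝ)..2 * π, (circleMap 0 1 θ) ^ (-m) *
        Complex.exp (-((z + y * (circleMap 0 1 θ)⁻¹) / 2 * Real.exp x)
          - (z - y * circleMap 0 1 θ) / 2 * Real.exp (-x)))
        = 2 * π * ((Real.exp (-m * x) * Real.exp (-z * Real.cosh x) * besselJ m y : ℝ) : ℂ) := by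
      intro x
      rw [Complex.ofReal_mul, besselJ_eq_circle m y (Real.exp_pos (-x))]
      rw [hcancel, ← intervalIntegral.integral_const_mul]
      refine intervalIntegral.integral_congr fun θ _ => ?_
      have e1 : circleMap 0 (Real.exp (-x)) θ = Real.exp (-x) * circleMap 0 1 θ := by
        simp [circleMap]
      have e2 : ((Real.exp (-x) : ℝ) : ℂ) ^ (-m) = ((Real.exp (m * x) : ℝ) : ℂ) := by
        rw [← Complex.ofReal_zpow, ← Real.rpow_intCast, ← Real.exp_mul]; push_cast; ring_nf
      have e3 : ((Real.exp (-x) : ℝ) : ℂ)⁻¹ = Real.exp x := by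
        rw [← Complex.ofReal_inv, ← Real.exp_neg, neg_neg]
      rw [e1, mul_zpow, e2, mul_inv, e3]
      have e4 : ((Real.exp (-m * x) * Real.exp (-z * Real.cosh x) : ℝ) : ℂ) *
          (Real.exp (m * x) * circleMap 0 1 θ ^ (-m) *
            Complex.exp (y / 2 * (Real.exp (-x) * circleMap 0 1 θ
              - Real.exp x * (circleMap 0 1 θ)⁻¹)))
          = circleMap 0 1 θ ^ (-m) * (((Real.exp (-m * x) * Real.exp (m * x) : ℝ) : ℂ) *
            (((Real.exp (-z * Real.cosh x) : ℝ) : ℂ) *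
            Complex.exp (y / 2 * (Real.exp (-x) * circleMap 0 1 θ
              - Real.exp x * (circleMap 0 1 θ)⁻¹)))) := by
        push_cast; ring
      rw [e4, ← Real.exp_add, show -(m : ℝ) * x + m * x = 0 by ring, Real.exp_zero,
        Complex.ofReal_one, one_mul, Complex.ofReal_exp (-z * Real.cosh x), ← Complex.exp_add,
        Real.cosh_eq]
      congr 2
      push_cast
      ring
    have hR : ∀ x : ℝ, (∫ θ in (0:ℝ)..2 * π, (circleMap 0 1 θ) ^ (-m) *
        Complex.exp (-((q - γ / 2 * (circleMap 0 1 θ - (circleMap 0 1 θ)⁻¹)) * Real.exp x)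
          - p * Real.exp (-x)))
        = 2 * π * ((Real.exp (-(q * Real.exp x) - p * Real.exp (-x)) *
            besselJ m (γ * Real.exp x) : ℝ) : ℂ) := by
      intro x
      rw [Complex.ofReal_mul, besselJ_eq_circle m _ one_pos]
      rw [hcancel, ← intervalIntegral.integral_const_mul]
      refine intervalIntegral.integral_congr fun θ _ => ?_
      rw [mul_left_comm, Complex.ofReal_exp (_ - _), ← Complex.exp_add]
      congr 2
      push_cast
      ring
    simp_rw [hL, hR] at hswap
    rw [integral_const_mul, integral_const_mul] at hswap
    have h1 := mul_left_cancel₀ hpi hswap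
    rw [integral_complex_ofReal, integral_complex_ofReal] at h1
    rw [← Complex.ofReal_inj.1 h1, integral_mul_const, ← two_mul_besselK m hz]
    ring
  · rw [hinv_eq, Complex.div_ofNat_re, Complex.add_re, Complex.re_ofReal_mul, Complex.ofReal_re,
      Complex.conj_re]
    have := (abs_le.1 (hyre θ)).1
    linarith
  · rw [Complex.div_ofNat_re, Complex.sub_re, Complex.re_ofReal_mul, Complex.ofReal_re]
    have := (abs_le.1 (hyre θ)).2
    linarith
  · rw [hinv_eq, Complex.sub_conj]
    simp
  · have h1 : (z : ℂ) ^ 2 - y ^ 2 = 4 * p * q := by exact_mod_cast hsq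
    have h2 : (y : ℂ) * z = 2 * p * γ := by exact_mod_cast hmul
    have h3 : circleMap 0 1 θ * (circleMap 0 1 θ)⁻¹ = 1 := mul_inv_cancel₀ (hne θ)
    linear_combination (1 / 4 : ℂ) * h1
      - (circleMap 0 1 θ - (circleMap 0 1 θ)⁻¹) / 4 * h2 - y ^ 2 / 4 * h3

theorem integral_Ioi_inv_mul_besselJ (m : ℤ) {p q γ : ℝ} (hp : 0 < p) (hq : 0 < q) (hγ : 0 < γ) :
    ∫ t in Set.Ioi (0:ℝ), t⁻¹ * (Real.exp (-(q * t) - p / t) * besselJ m (γ * t))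
      = 2 * (besselJ m (Real.sqrt (2 * p) * Real.sqrt (Real.sqrt (q ^ 2 + γ ^ 2) - q)) *
        besselK m (Real.sqrt (2 * p) * Real.sqrt (Real.sqrt (q ^ 2 + γ ^ 2) + q))) := by
  have hs : Real.sqrt (q ^ 2 + γ ^ 2) ^ 2 = q ^ 2 + γ ^ 2 := Real.sq_sqrt (by positivity)
  have hqs : q < Real.sqrt (q ^ 2 + γ ^ 2) := Real.lt_sqrt_of_sq_lt (by nlinarith [sq_pos_of_pos hγ])
  set s := Real.sqrt (q ^ 2 + γ ^ 2)
  have hm : Real.sqrt (s - q) ^ 2 = s - q := Real.sq_sqrt (by linarith)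
  have hpl : Real.sqrt (s + q) ^ 2 = s + q := Real.sq_sqrt (by linarith)
  have h2p : Real.sqrt (2 * p) ^ 2 = 2 * p := Real.sq_sqrt (by positivity)
  have hmpl : Real.sqrt (s - q) * Real.sqrt (s + q) = γ := by
    rw [← Real.sqrt_mul (by linarith), show (s - q) * (s + q) = γ ^ 2 by linear_combination hs,
      Real.sqrt_sq hγ.le]
  rw [← integral_exp_mul_besselJ m hp hq (γ := γ), integral_Ioi_eq_integral_exp]
  · refine integral_congr_ae (Filter.Eventually.of_forall fun x => ?_)
    simp only [smul_eq_mul]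
    rw [mul_inv_cancel_left₀ (Real.exp_pos x).ne', Real.exp_neg x, div_eq_mul_inv]
  · rw [abs_of_nonneg (by positivity)]
    gcongr
    linarith
  · rw [mul_pow, mul_pow, hm, hpl, h2p]; ring
  · linear_combination Real.sqrt (s - q) * Real.sqrt (s + q) * h2p + 2 * p * hmpl

theorem abs_besselJ_le_one (m : ℤ) (x : ℝ) : |besselJ m x| ≤ 1 := by
  have h := intervalIntegral.norm_integral_le_of_norm_le_const (a := 0) (b := Real.pi) (C := 1)
    (f := fun θ => Real.cos ((m : ℝ) * θ - x * Real.sin θ)) fun θ _ => Real.abs_cos_le_one _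
  rw [sub_zero, one_mul, abs_of_pos Real.pi_pos, Real.norm_eq_abs] at h
  rw [besselJ, abs_mul, abs_of_pos (by positivity)]
  calc _ ≤ 1 / Real.pi * Real.pi := by gcongr
    _ = 1 := by field_simp

theorem continuous_besselJ (m : ℤ) : Continuous (besselJ m) :=
  continuous_const.mul
    (intervalIntegral.continuous_parametric_intervalIntegral_of_continuous' (by fun_prop) _ _)

theorem integrableOn_pow_mul_exp_mul_besselJ (m : ℤ) (j : ℕ) (γ : ℝ) {p q : ℝ} (hp : 0 < p)
    (hq : 0 < q) :
    IntegrableOn (fun t => (-t) ^ j * (t⁻¹ * (Real.exp (-(q * t) - p / t) * besselJ m (γ * t))))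
      (Set.Ioi 0) := by
  have hb := integrableOn_rpow_mul_exp_neg_sub_div (j - 1 : ℝ) hq hp
  refine hb.mono' (Measurable.aestronglyMeasurable ?_) ?_
  · have := (continuous_besselJ m).measurable
    fun_prop
  · refine (ae_restrict_iff' measurableSet_Ioi).2 (Filter.Eventually.of_forall fun t ht => ?_)
    have ht : 0 < t := ht
    rw [norm_mul, norm_mul, norm_mul, norm_pow, norm_neg, norm_inv, Real.norm_eq_abs,
      Real.norm_eq_abs, Real.norm_eq_abs, abs_of_pos ht, Real.abs_exp, Real.rpow_sub_one ht.ne',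
      Real.rpow_natCast, ← mul_assoc, ← div_eq_mul_inv]
    gcongr
    exact mul_le_of_le_one_right (Real.exp_pos _).le (abs_besselJ_le_one m _)

theorem hasDerivAt_integral_pow_mul_exp_mul_besselJ (m : ℤ) (j : ℕ) (γ : ℝ) {p q : ℝ} (hp : 0 < p)
    (hq : 0 < q) :
    HasDerivAt (fun q => ∫ t in Set.Ioi (0:ℝ),
        (-t) ^ j * (t⁻¹ * (Real.exp (-(q * t) - p / t) * besselJ m (γ * t))))
      (∫ t in Set.Ioi (0:ℝ),
        (-t) ^ (j + 1) * (t⁻¹ * (Real.exp (-(q * t) - p / t) * besselJ m (γ * t)))) q := by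
  have hb := integrableOn_rpow_mul_exp_neg_sub_div j (half_pos hq) hp
  have hmeas := (continuous_besselJ m).measurable
  refine (hasDerivAt_integral_of_dominated_loc_of_deriv_le (μ := volume.restrict (Set.Ioi 0))
    (F := fun q t => (-t) ^ j * (t⁻¹ * (Real.exp (-(q * t) - p / t) * besselJ m (γ * t))))
    (F' := fun q t => (-t) ^ (j + 1) * (t⁻¹ * (Real.exp (-(q * t) - p / t) * besselJ m (γ * t))))
    (Ioi_mem_nhds (half_lt_self hq))
    (Filter.Eventually.of_forall fun q => Measurable.aestronglyMeasurable (by fun_prop))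
    (integrableOn_pow_mul_exp_mul_besselJ m j γ hp hq)
    (Measurable.aestronglyMeasurable (by fun_prop)) ?_ hb
    (Filter.Eventually.of_forall fun t q _ => ?_)).2
  · refine (ae_restrict_iff' measurableSet_Ioi).2 (Filter.Eventually.of_forall fun t ht q' hq' => ?_)
    have ht : 0 < t := ht
    have hq' : q / 2 < q' := hq'
    rw [norm_mul, norm_mul, norm_mul, norm_pow, norm_neg, norm_inv, Real.norm_eq_abs,
      Real.norm_eq_abs, Real.norm_eq_abs, abs_of_pos ht, Real.abs_exp, Real.rpow_natCast, pow_succ,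
      mul_assoc, mul_inv_cancel_left₀ ht.ne']
    gcongr
    refine (mul_le_of_le_one_right (Real.exp_pos _).le (abs_besselJ_le_one m _)).trans ?_
    gcongr
  · have h1 : HasDerivAt (fun q : ℝ => -(q * t) - p / t) (-(1 * t)) q :=
      (((hasDerivAt_id q).mul_const t).neg).sub_const _
    refine (((h1.exp.mul_const (besselJ m (γ * t))).const_mul t⁻¹).const_mul
      ((-t) ^ j)).congr_deriv ?_
    ring

theorem iteratedDeriv_besselJ_mul_besselK (m : ℤ) (j : ℕ) {p q γ : ℝ} (hp : 0 < p) (hq : 0 < q)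
    (hγ : 0 < γ) :
    2 * iteratedDeriv j (fun q : ℝ =>
        besselJ m (Real.sqrt (2 * p) * Real.sqrt (Real.sqrt (q ^ 2 + γ ^ 2) - q)) *
          besselK m (Real.sqrt (2 * p) * Real.sqrt (Real.sqrt (q ^ 2 + γ ^ 2) + q))) q
      = ∫ t in Set.Ioi (0:ℝ),
        (-t) ^ j * (t⁻¹ * (Real.exp (-(q * t) - p / t) * besselJ m (γ * t))) := by
  induction j generalizing q with
  | zero => simp only [iteratedDeriv_zero, pow_zero, one_mul,
      integral_Ioi_inv_mul_besselJ m hp hq hγ]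
  | succ j ih =>
    rw [iteratedDeriv_succ, ← deriv_const_mul_field,
      ← (hasDerivAt_integral_pow_mul_exp_mul_besselJ m j γ hp hq).deriv]
    exact Filter.EventuallyEq.deriv_eq (Filter.eventually_of_mem (Ioi_mem_nhds hq) fun q hq => ih hq)

theorem inv_exp_sub_one_le {t : ℝ} (ht : 0 < t) :
    (Real.exp t - 1)⁻¹ ≤ Real.exp (-t) + t⁻¹ * Real.exp (-t) := by
  have h1 : t ≤ Real.exp t - 1 := by linarith [Real.add_one_le_exp t]
  rw [inv_le_iff_one_le_mul₀ (ht.trans_le h1)]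
  calc (1 : ℝ) = Real.exp (-t) * Real.exp t := by rw [← Real.exp_add]; simp
    _ = Real.exp (-t) * (Real.exp t - 1) + t⁻¹ * Real.exp (-t) * t := by field_simp; ring
    _ ≤ Real.exp (-t) * (Real.exp t - 1) + t⁻¹ * Real.exp (-t) * (Real.exp t - 1) := by gcongr
    _ = _ := by ring

theorem integrableOn_rpow_mul_exp_mul_inv_exp_sub_one (k : ℝ) {p A : ℝ} (hp : 0 < p) (hA : A < 1) :
    IntegrableOn (fun t => t ^ k * (Real.exp (-p / t) * (Real.exp t - 1)⁻¹) * Real.exp (A * t))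
      (Set.Ioi 0) := by
  have hA' : 0 < 1 - A := by linarith
  refine ((integrableOn_rpow_mul_exp_neg_sub_div k hA' hp).add
    (integrableOn_rpow_mul_exp_neg_sub_div (k - 1) hA' hp)).mono'
    (Measurable.aestronglyMeasurable (by fun_prop))
    ((ae_restrict_iff' measurableSet_Ioi).2 (Filter.Eventually.of_forall fun t ht => ?_))
  have ht : 0 < t := ht
  have h1 : 0 < Real.exp t - 1 := by linarith [Real.add_one_lt_exp ht.ne']
  have h2 : Real.exp (-((1 - A) * t) - p / t)
      = Real.exp (-p / t) * Real.exp (-t) * Real.exp (A * t) := by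
    rw [← Real.exp_add, ← Real.exp_add]; ring_nf
  rw [Real.norm_of_nonneg (by positivity), Pi.add_apply, Real.rpow_sub_one ht.ne', h2]
  calc _ ≤ t ^ k * (Real.exp (-p / t) * (Real.exp (-t) + t⁻¹ * Real.exp (-t))) *
        Real.exp (A * t) := by gcongr; exact inv_exp_sub_one_le ht
    _ = _ := by ring

theorem hasSum_exp_neg_add_one_mul {t : ℝ} (ht : 0 < t) :
    HasSum (fun k : ℕ => Real.exp (-((k + 1 : ℝ) * t))) (Real.exp t - 1)⁻¹ := by
  have h := (hasSum_geometric_of_lt_one (Real.exp_pos (-t)).le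
    (Real.exp_lt_one_iff.2 (neg_lt_zero.2 ht))).mul_left (Real.exp (-t))
  have h2 : Real.exp (-t) * (1 - Real.exp (-t))⁻¹ = (Real.exp t - 1)⁻¹ := by
    rw [Real.exp_neg, ← mul_inv, mul_sub, mul_one, mul_inv_cancel₀ (Real.exp_pos t).ne']
  rw [h2] at h
  refine h.congr_fun fun k => ?_
  rw [← Real.exp_nat_mul, ← Real.exp_add]
  ring_nf

theorem hasSum_integral_exp_neg_mul_besselJ (m : ℤ) (j : ℕ) (γ : ℝ) {p : ℝ} (hp : 0 < p) :
    HasSum (fun k : ℕ => ∫ t in Set.Ioi (0:ℝ), (-t) ^ j *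
        (t⁻¹ * (Real.exp (-((k + 1 : ℝ) * t) - p / t) * besselJ m (γ * t))))
      (∫ t in Set.Ioi (0:ℝ), (-1) ^ j *
        (t ^ (j - 1 : ℝ) * (Real.exp (-p / t) * (Real.exp t - 1)⁻¹) * besselJ m (γ * t))) := by
  have hmeas := (continuous_besselJ m).measurable
  have hsum : ∀ t : ℝ, 0 < t → HasSum (fun k : ℕ => t ^ (j - 1 : ℝ) *
      (Real.exp (-p / t) * Real.exp (-((k + 1 : ℝ) * t))))
      (t ^ (j - 1 : ℝ) * (Real.exp (-p / t) * (Real.exp t - 1)⁻¹)) := fun t ht =>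
    ((hasSum_exp_neg_add_one_mul ht).mul_left _).mul_left _
  have hterm : ∀ (k : ℕ) (t : ℝ), 0 < t → (-t) ^ j *
      (t⁻¹ * (Real.exp (-((k + 1 : ℝ) * t) - p / t) * besselJ m (γ * t)))
      = (-1) ^ j * (t ^ (j - 1 : ℝ) * (Real.exp (-p / t) * Real.exp (-((k + 1 : ℝ) * t))) *
        besselJ m (γ * t)) := by
    intro k t ht
    rw [Real.rpow_sub_one ht.ne', Real.rpow_natCast, neg_pow, ← Real.exp_add]
    ring_nf
  refine hasSum_integral_of_dominated_convergence (fun (k : ℕ) t => t ^ (j - 1 : ℝ) *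
      (Real.exp (-p / t) * Real.exp (-((k + 1 : ℝ) * t))))
    (fun k => Measurable.aestronglyMeasurable (by fun_prop)) (fun k => ?_) ?_ ?_ ?_
  · refine (ae_restrict_iff' measurableSet_Ioi).2 (Filter.Eventually.of_forall fun t ht => ?_)
    have ht : 0 < t := ht
    rw [hterm k t ht, norm_mul, norm_pow, norm_neg, norm_one, one_pow, one_mul, norm_mul,
      Real.norm_of_nonneg (by positivity)]
    exact mul_le_of_le_one_right (by positivity) (abs_besselJ_le_one m _)
  · exact (ae_restrict_iff' measurableSet_Ioi).2
      (Filter.Eventually.of_forall fun t ht => (hsum t ht).summable)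
  · refine (integrableOn_rpow_mul_exp_mul_inv_exp_sub_one (j - 1) hp zero_lt_one).congr
      ((ae_restrict_iff' measurableSet_Ioi).2 (Filter.Eventually.of_forall fun t ht => ?_))
    simp only [(hsum t ht).tsum_eq, zero_mul, Real.exp_zero, mul_one]
  · refine (ae_restrict_iff' measurableSet_Ioi).2 (Filter.Eventually.of_forall fun t ht => ?_)
    simp only [hterm _ t ht]
    exact ((hsum t ht).mul_right _).mul_left _

theorem hasSum_integral_mul_besselJ {m : ℤ} (hm : -1 ≤ m) {γ : ℝ} (hγ : 0 < γ) {w : ℝ → ℝ}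
    (hw : Measurable w) (hw0 : ∀ t, 0 < t → 0 ≤ w t)
    (hint : IntegrableOn (fun t => w t * Real.exp (γ * t)) (Set.Ioi 0)) :
    HasSum (fun k : ℕ => ∫ t in Set.Ioi (0:ℝ), w t *
        ((-1) ^ k * ((γ * t / 2) ^ (2 * k + m) / (k.factorial * Real.Gamma (k + m + 1)))))
      (∫ t in Set.Ioi (0:ℝ), w t * besselJ m (γ * t)) := by
  have hpos : ∀ (k : ℕ) (t : ℝ), 0 < t →
      0 ≤ (γ * t / 2) ^ (2 * k + m) / (k.factorial * Real.Gamma (k + m + 1)) := by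
    intro k t ht
    have h1 : (0 : ℝ) ≤ k + m + 1 := by
      have : (-1 : ℝ) ≤ m := by exact_mod_cast hm
      have := k.cast_nonneg (α := ℝ)
      linarith
    have := Real.Gamma_nonneg_of_nonneg h1
    positivity
  have hnorm : ∀ (k : ℕ) (t : ℝ), 0 < t → ‖w t *
      ((-1) ^ k * ((γ * t / 2) ^ (2 * k + m) / (k.factorial * Real.Gamma (k + m + 1))))‖
      = w t * ((γ * t / 2) ^ (2 * k + m) / (k.factorial * Real.Gamma (k + m + 1))) := by
    intro k t ht
    rw [norm_mul, norm_mul, norm_pow, norm_neg, norm_one, one_pow, one_mul,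
      Real.norm_of_nonneg (hw0 t ht), Real.norm_of_nonneg (hpos k t ht)]
  have hle : ∀ (N : ℕ) (t : ℝ), 0 < t → ∑ k ∈ Finset.range N, ‖w t *
      ((-1) ^ k * ((γ * t / 2) ^ (2 * k + m) / (k.factorial * Real.Gamma (k + m + 1))))‖
      ≤ w t * Real.exp (γ * t) := by
    intro N t ht
    rw [Finset.sum_congr rfl fun k _ => hnorm k t ht, ← Finset.mul_sum]
    exact mul_le_mul_of_nonneg_left (sum_besselI_terms_le m hm (mul_pos hγ ht) N) (hw0 t ht)
  have hF : ∀ k : ℕ, IntegrableOn (fun t => w t *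
      ((-1) ^ k * ((γ * t / 2) ^ (2 * k + m) / (k.factorial * Real.Gamma (k + m + 1)))))
      (Set.Ioi 0) := by
    intro k
    refine hint.mono' (Measurable.aestronglyMeasurable ?_)
      ((ae_restrict_iff' measurableSet_Ioi).2 (Filter.Eventually.of_forall fun t ht =>
        (Finset.single_le_sum (f := fun k : ℕ => ‖w t * ((-1) ^ k * ((γ * t / 2) ^ (2 * k + m) /
          (k.factorial * Real.Gamma (k + m + 1))))‖) (fun _ _ => norm_nonneg _)
          (Finset.self_mem_range_succ k)).trans
          (hle (k + 1) t ht)))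
    fun_prop
  have hsummable : Summable fun k : ℕ => ∫ t in Set.Ioi (0:ℝ), ‖w t *
      ((-1) ^ k * ((γ * t / 2) ^ (2 * k + m) / (k.factorial * Real.Gamma (k + m + 1))))‖ := by
    refine summable_of_sum_range_le (c := ∫ t in Set.Ioi (0:ℝ), w t * Real.exp (γ * t))
      (fun k => integral_nonneg fun t => norm_nonneg _) fun N => ?_
    rw [← integral_finsetSum _ fun k _ => (hF k).norm]
    exact setIntegral_mono_on (integrable_finsetSum _ fun k _ => (hF k).norm) hint
      measurableSet_Ioi fun t ht => hle N t ht
  have h := hasSum_integral_of_summable_integral_norm hF hsummable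
  rwa [setIntegral_congr_fun measurableSet_Ioi fun t ht =>
    ((besselJ_hasSum m (mul_pos hγ ht).ne').mul_left (w t)).tsum_eq] at h

theorem Gamma_add_half_mul_zetaP {p s : ℝ} (hs : 0 ≤ s) :
    Real.Gamma (s + 1 / 2) * zetaP p (2 * s) = 2 ^ (1 - 2 * s) * Real.sqrt Real.pi *
      (Real.Gamma s)⁻¹ * ∫ t in Set.Ioi (0:ℝ), t ^ (2 * s - 1) * Real.exp (-p / t) /
        (Real.exp t - 1) := by
  rcases hs.eq_or_lt with rfl | hs
  · simp [zetaP]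
  · have h := Real.Gamma_mul_Gamma_add_half s
    have h1 := (Real.Gamma_pos_of_pos hs).ne'
    have h2 := (Real.Gamma_pos_of_pos (mul_pos two_pos hs)).ne'
    have h3 : Real.Gamma (s + 1 / 2) * (1 / Real.Gamma (2 * s))
        = 2 ^ (1 - 2 * s) * Real.sqrt Real.pi * (Real.Gamma s)⁻¹ := by
      rw [mul_one_div, div_eq_iff h2, mul_right_comm, ← div_eq_mul_inv, eq_div_iff h1]
      linear_combination h
    rw [zetaP, ← h3, mul_assoc]

theorem mathieuS_eq_integral {p γ : ℝ} (hp : 0 < p) (hγ0 : 0 < γ) (hγ1 : γ < 1) {n : ℕ}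
    (hn : 1 ≤ n) :
    mathieuS ((n : ℝ) - 3 / 2) p γ =
      Real.sqrt Real.pi / ((2 * γ) ^ ((n : ℤ) - 2) * Real.Gamma ((n : ℝ) - 1 / 2)) *
        ∫ t in Set.Ioi (0:ℝ), t ^ (n - 1 : ℝ) * (Real.exp (-p / t) * (Real.exp t - 1)⁻¹) *
          besselJ ((n : ℤ) - 2) (γ * t) := by
  have hn' : (1 : ℝ) ≤ n := by exact_mod_cast hn
  have hsum := hasSum_integral_mul_besselJ (m := (n : ℤ) - 2) (by omega) hγ0
    (w := fun t => t ^ (n - 1 : ℝ) * (Real.exp (-p / t) * (Real.exp t - 1)⁻¹)) (by fun_prop)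
    (fun t ht => by
      have : 0 < Real.exp t - 1 := by linarith [Real.add_one_lt_exp ht.ne']
      positivity)
    (integrableOn_rpow_mul_exp_mul_inv_exp_sub_one _ hp hγ1)
  rw [← hsum.tsum_eq, mathieuS, ← tsum_mul_left, ← tsum_mul_left]
  refine tsum_congr fun k => ?_
  have hz := Gamma_add_half_mul_zetaP (p := p) (s := n - 1 + k)
    (by have := k.cast_nonneg (α := ℝ); linarith)
  have hint : ∫ t in Set.Ioi (0:ℝ), t ^ (n - 1 : ℝ) * (Real.exp (-p / t) * (Real.exp t - 1)⁻¹) *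
      ((-1) ^ k * ((γ * t / 2) ^ (2 * k + ((n : ℤ) - 2)) /
        (k.factorial * Real.Gamma (k + ((n : ℤ) - 2 : ℤ) + 1))))
      = (-1) ^ k * (γ / 2) ^ (2 * k + ((n : ℤ) - 2)) /
        (k.factorial * Real.Gamma (n - 1 + k)) *
        ∫ t in Set.Ioi (0:ℝ), t ^ (2 * (n - 1 + k) - 1 : ℝ) * Real.exp (-p / t) /
        (Real.exp t - 1) := by
    rw [← integral_const_mul]
    refine setIntegral_congr_fun measurableSet_Ioi fun t ht => ?_
    have ht : 0 < t := ht
    have h1 : t ^ (2 * (n - 1 + k) - 1 : ℝ) = t ^ (n - 1 : ℝ) * t ^ (2 * k + ((n : ℤ) - 2)) := by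
      rw [← Real.rpow_intCast, ← Real.rpow_add ht]
      push_cast
      ring_nf
    have h2 : (k + ((n : ℤ) - 2 : ℤ) + 1 : ℝ) = n - 1 + k := by push_cast; ring
    simp only [h1, h2]
    rw [show γ * t / 2 = γ / 2 * t by ring, mul_zpow]
    ring
  rw [hint]
  set I := ∫ t in Set.Ioi (0:ℝ), t ^ (2 * (n - 1 + k) - 1 : ℝ) * Real.exp (-p / t) /
        (Real.exp t - 1)
  rw [show (n : ℝ) - 3 / 2 + k + 1 = n - 1 + k + 1 / 2 by ring,
    show 2 * ((n : ℝ) - 3 / 2) + 2 * k + 1 = 2 * (n - 1 + k) by ring,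
    show (n : ℝ) - 3 / 2 + 1 = n - 1 / 2 by ring]
  have hpow : (2 : ℝ) * (2 ^ (1 - 2 * (n - 1 + k) : ℝ) * γ ^ (2 * k))
      = ((2 * γ) ^ ((n : ℤ) - 2))⁻¹ * (γ / 2) ^ (2 * k + ((n : ℤ) - 2)) := by
    rw [show (1 - 2 * (n - 1 + k) : ℝ) = ((1 - 2 * (n - 1 + k) : ℤ) : ℝ) by push_cast; ring,
      Real.rpow_intCast, mul_zpow, div_zpow, zpow_add₀ hγ0.ne', mul_inv, ← zpow_natCast γ]
    have h4 : (2 : ℝ) * 2 ^ (1 - 2 * (n - 1 + k) : ℤ)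
        = (2 ^ ((n : ℤ) - 2))⁻¹ * (2 ^ (2 * k + ((n : ℤ) - 2)))⁻¹ := by
      rw [← zpow_neg, ← zpow_neg, ← zpow_add₀ two_ne_zero, ← zpow_one_add₀ two_ne_zero]
      congr 1
      ring
    have h5 : (γ ^ ((n : ℤ) - 2))⁻¹ * γ ^ ((n : ℤ) - 2) = 1 :=
      inv_mul_cancel₀ (zpow_ne_zero _ hγ0.ne')
    rw [← mul_assoc, h4]
    push_cast
    linear_combination (-(2 ^ ((n : ℤ) - 2))⁻¹ * (2 ^ (2 * k + ((n : ℤ) - 2)))⁻¹ *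
      γ ^ (2 * k : ℤ)) * h5
  calc _ = 2 * ((-1) ^ k * (Real.Gamma (n - 1 + k + 1 / 2) * zetaP p (2 * (n - 1 + k))) /
        (k.factorial * Real.Gamma (n - 1 / 2)) * γ ^ (2 * k)) := by ring
    _ = (2 * (2 ^ (1 - 2 * (n - 1 + k) : ℝ) * γ ^ (2 * k))) * ((-1) ^ k * Real.sqrt Real.pi *
        (Real.Gamma (n - 1 + k))⁻¹ * I / (k.factorial * Real.Gamma (n - 1 / 2))) := by
      rw [hz]; ring
    _ = _ := by
      rw [hpow]
      simp only [div_eq_mul_inv, mul_inv]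
      ring

theorem stmt0 (p γ : ℝ) (hp : 0 < p) (hγ0 : 0 < γ) (hγ1 : γ < 1)
    (n : ℕ) (hn : 1 ≤ n) :
    mathieuS ((n : ℝ) - 3/2) p γ =
      (2 * (-1 : ℝ) ^ n * Real.sqrt Real.pi /
          ((2 * γ) ^ ((n : ℤ) - 2) * Real.Gamma ((n : ℝ) - 1/2))) *
        ∑' k : ℕ, iteratedDeriv n
          (fun q : ℝ =>
            besselJ ((n : ℤ) - 2)
                (Real.sqrt (2 * p) * Real.sqrt (Real.sqrt (q ^ 2 + γ ^ 2) - q)) *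
              besselK ((n : ℝ) - 2)
                (Real.sqrt (2 * p) * Real.sqrt (Real.sqrt (q ^ 2 + γ ^ 2) + q)))
          (k + 1) := by
  have hcast : (n : ℝ) - 2 = ((n : ℤ) - 2 : ℤ) := by push_cast; rfl
  have hderiv := fun k : ℕ => iteratedDeriv_besselJ_mul_besselK ((n : ℤ) - 2) n (q := k + 1) hp
    k.cast_add_one_pos hγ0
  have hsum := hasSum_integral_exp_neg_mul_besselJ ((n : ℤ) - 2) n γ hp
  simp only [← hderiv, ← hcast] at hsum
  have h := hsum.tsum_eq
  rw [tsum_mul_left, integral_const_mul] at h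
  rw [mathieuS_eq_integral hp hγ0 hγ1 hn]
  have hsign : ((-1 : ℝ) ^ n) * (-1) ^ n = 1 := by rw [← mul_pow]; simp
  set I := ∫ t in Set.Ioi (0:ℝ), t ^ (n - 1 : ℝ) * (Real.exp (-p / t) * (Real.exp t - 1)⁻¹) *
    besselJ ((n : ℤ) - 2) (γ * t)
  calc _ = Real.sqrt Real.pi / ((2 * γ) ^ ((n : ℤ) - 2) * Real.Gamma ((n : ℝ) - 1 / 2)) *
        ((-1) ^ n * ((-1) ^ n * I)) := by rw [← mul_assoc _ _ I, hsign, one_mul]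
    _ = _ := by rw [← h]; ring
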